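/- Let P be a finite (3+1)-free poset with clone sets C_1, …, C_r and tangles T_1, …, T_s. Then there exists a listing (X_1, …, X_{r+s}) of the clone sets and tangles of P such that, for any two vertices a ∈ X_i and b ∈ X_j with i ≠ j, we have a < b exactly when ℓ(a) ≤ ℓ(b) − 2, or ℓ(a) = ℓ(b) − 1 and i < j. -/

import Mathlib

/-- Two elements of a poset are incomparable. -/
def Incomp {β : Type*} [PartialOrder β] (x y : β) : Prop := ¬ x ≤ y ∧ ¬ y ≤ x

/-- A poset is `(3+1)`-free if it contains no induced subposet consisting of a
3-element chain together with an incomparable extra element. -/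
def ThreePlusOneFree (α : Type*) [PartialOrder α] : Prop :=
  ¬ ∃ a b c d : α, a < b ∧ b < c ∧ Incomp d a ∧ Incomp d b ∧ Incomp d c

variable {α : Type*} [PartialOrder α]

/-- The strict downset `D_a` of a vertex. -/
def Dset (a : α) : Set α := {x | x < a}

/-- The strict upset `U_a` of a vertex. -/
def Uset (a : α) : Set α := {x | a < x}

/-- `a ⊤⊤ b` : the strict downsets of `a` and `b` are incomparable under inclusion. -/
def TTrel (a b : α) : Prop := ¬ Dset a ⊆ Dset b ∧ ¬ Dset b ⊆ Dset a

/-- `a ⊥⊥ b` : the strict upsets of `a` and `b` are incomparable under inclusion. -/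
def BBrel (a b : α) : Prop := ¬ Uset a ⊆ Uset b ∧ ¬ Uset b ⊆ Uset a

/-- The view `v(a) = (D_a, P \ U_a)` of a vertex, an element of `Set α × Set α`
with the componentwise inclusion order; note `v(a) ≤ v(b) ↔ D_a ⊆ D_b ∧ U_b ⊆ U_a`. -/
def view (a : α) : Set α × Set α := (Dset a, (Uset a)ᶜ)

/-- A top of a tangle: a connected component, with at least two vertices, of the graph
on the vertices of `P` with edge relation `⊤⊤`. -/
def IsTopOfTangle (A : Set α) : Prop :=
  2 ≤ A.ncard ∧ ∃ a, A = {b | Relation.ReflTransGen TTrel a b}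

/-- A bottom of a tangle: a connected component, with at least two vertices, of the graph
on the vertices of `P` with edge relation `⊥⊥`. -/
def IsBottomOfTangle (B : Set α) : Prop :=
  2 ≤ B.ncard ∧ ∃ b, B = {a | Relation.ReflTransGen BBrel b a}

/-- A top of a tangle `A` and a bottom of a tangle `B` are matched when they contain the
top and bottom pairs of an induced `(2+2)` subposet. -/
def Matched (A B : Set α) : Prop :=
  ∃ a ∈ A, ∃ a' ∈ A, ∃ b ∈ B, ∃ b' ∈ B,
    b < a ∧ b' < a' ∧ Incomp a a' ∧ Incomp b b' ∧ Incomp a b' ∧ Incomp a' b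

/-- A tangle, regarded as a vertex set: the union of a matched top and bottom. -/
def IsTangle (X : Set α) : Prop :=
  ∃ A B : Set α, IsTopOfTangle A ∧ IsBottomOfTangle B ∧ Matched A B ∧ X = A ∪ B

/-- A vertex lying in no top of a tangle and no bottom of a tangle. -/
def NotInTanglePart (a : α) : Prop :=
  (∀ A : Set α, IsTopOfTangle A → a ∉ A) ∧ (∀ B : Set α, IsBottomOfTangle B → a ∉ B)

/-- A clone set: an equivalence class under "same view" of the vertices lying in no
top or bottom of a tangle. -/
def IsCloneSet (C : Set α) : Prop :=
  ∃ a : α, NotInTanglePart a ∧ C = {b | NotInTanglePart b ∧ view b = view a}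

/-- The parts of a `(3+1)`-free poset: its clone sets and its tangles. -/
def IsPart (X : Set α) : Prop := IsCloneSet X ∨ IsTangle X

/-- The level `ℓ(a)` of a vertex: the maximum number of elements in a chain of `P`
whose greatest element is `a`. -/
noncomputable def level (a : α) : ℕ :=
  sSup {n | ∃ s : Finset α, s.card = n ∧ IsChain (· ≤ ·) (↑s : Set α) ∧ a ∈ s ∧ ∀ x ∈ s, x ≤ a}

/-- A compatible listing of the parts of a `(3+1)`-free poset: an enumeration
`X_1, …, X_k` (each part listed exactly once) such that for vertices in distinct parts,
`a < b` holds exactly when `ℓ(a) ≤ ℓ(b) - 2`, or `ℓ(a) = ℓ(b) - 1` and `i < j`. -/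
noncomputable def CompatibleListing {k : ℕ} (X : Fin k → Set α) : Prop :=
  Function.Injective X ∧ (∀ Y : Set α, IsPart Y ↔ ∃ i, X i = Y) ∧
    ∀ i j : Fin k, i ≠ j → ∀ a ∈ X i, ∀ b ∈ X j,
      (a < b ↔ (level a + 2 ≤ level b ∨ (level a + 1 = level b ∧ i < j)))

open Relation

/-- `a` and `b` have `r`-downsets that are incomparable under inclusion. -/
def TopAdj {β : Type*} (r : β → β → Prop) (a b : β) : Prop :=
  ∃ x y, r x a ∧ ¬ r x b ∧ r y b ∧ ¬ r y a

/-- Connectedness in the graph of incomparable downsets. Applied to `flip r`, it is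
connectedness in the graph of incomparable upsets. -/
abbrev TopConn {β : Type*} (r : β → β → Prop) : β → β → Prop := ReflTransGen (TopAdj r)

/-- The inclusion order on views. -/
def ViewLE {β : Type*} (r : β → β → Prop) (a b : β) : Prop :=
  (∀ x, r x a → r x b) ∧ ∀ z, r b z → r a z

/-- `a` lies in the bottom and `b` in the top of a common tangle. -/
def TangleLink {β : Type*} (r : β → β → Prop) (a b : β) : Prop :=
  ∃ x y c d, TopConn (flip r) a x ∧ TopConn r c b ∧ r x c ∧ ¬ r x d ∧ r y d ∧ ¬ r y c

/-- A strict order `r` without induced `3+1`, with a level function `ℓ` that controls `r` up to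
consecutive levels. The notion is invariant under reversing `r` and negating `ℓ`. -/
structure LevelledFree {β : Type*} (r : β → β → Prop) (ℓ : β → ℤ) : Prop where
  free : ∀ {a b c : β}, r a b → r b c → ∀ d, r a d ∨ r d c
  lt : ∀ {a b : β}, r a b → ℓ a < ℓ b
  rel : ∀ {a b : β}, ℓ a + 2 ≤ ℓ b → r a b
  clone : ∀ {a b : β}, ViewLE r a b → ViewLE r b a → ℓ a = ℓ b

/-- The order induced on a single level. -/
def SameLE {β : Type*} (r : β → β → Prop) (ℓ : β → ℤ) (a b : β) : Prop :=
  ℓ a = ℓ b ∧ (ViewLE r a b ∨ TopConn r a b ∨ TopConn (flip r) a b)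

/-- `a` may be listed no later than `b`, which lies one level higher. -/
def UpStep {β : Type*} (r : β → β → Prop) (ℓ : β → ℤ) (a b : β) : Prop :=
  ℓ b = ℓ a + 1 ∧ (r a b ∨ TangleLink r a b)

/-- `a` may be listed no later than `b`, which lies one level lower. -/
def DownStep {β : Type*} (r : β → β → Prop) (ℓ : β → ℤ) (a b : β) : Prop :=
  ℓ a = ℓ b + 1 ∧ (¬ r b a ∨ TangleLink r b a)

/-- `a` is to be listed no later than `b`. -/
def ListLE {β : Type*} (r : β → β → Prop) (ℓ : β → ℤ) (a b : β) : Prop :=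
  SameLE r ℓ a b ∨ TransGen (UpStep r ℓ) a b ∨ TransGen (DownStep r ℓ) a b

/-- `a` and `b` lie in the same clone set or tangle. -/
def SamePart {β : Type*} (r : β → β → Prop) (a b : β) : Prop :=
  (ViewLE r a b ∧ ViewLE r b a) ∨ TopConn r a b ∨ TopConn (flip r) a b ∨
    TangleLink r a b ∨ TangleLink r b a

section Relations

variable {β : Type*} {r : β → β → Prop} {ℓ : β → ℤ} {a b c d x y z : β}

theorem TopAdj.symm (h : TopAdj r a b) : TopAdj r b a := by
  obtain ⟨x, y, h1, h2, h3, h4⟩ := h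
  exact ⟨y, x, h3, h4, h1, h2⟩

theorem TopConn.symm (h : TopConn r a b) : TopConn r b a := by
  induction h with
  | refl => exact .refl
  | tail _ h ih => exact .head h.symm ih

theorem TopConn.eq_or_topAdj (h : TopConn r a b) : a = b ∨ ∃ c, TopAdj r a c := by
  rcases h.cases_head with h | ⟨c, h, _⟩
  · exact .inl h
  · exact .inr ⟨c, h⟩

theorem TopConn.exists_topAdj (h : TopConn r a b) (h' : TopAdj r a c) : ∃ d, TopAdj r b d := by
  rcases h.symm.eq_or_topAdj with rfl | h
  exacts [⟨_, h'⟩, h]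

theorem ViewLE.trans (h : ViewLE r a b) (h' : ViewLE r b c) : ViewLE r a c :=
  ⟨fun x hx => h'.1 x (h.1 x hx), fun z hz => h.2 z (h'.2 z hz)⟩

theorem ViewLE.dual (h : ViewLE r a b) : ViewLE (flip r) b a := ⟨h.2, h.1⟩

theorem TangleLink.dual (h : TangleLink r a b) : TangleLink (flip r) b a := by
  obtain ⟨x, y, c, d, hx, hc, h1, h2, h3, h4⟩ := h
  exact ⟨c, d, x, y, hc.symm, hx.symm, h1, h4, h3, h2⟩

theorem TangleLink.of_conn (h : TangleLink r a b) (ha : TopConn (flip r) c a)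
    (hb : TopConn r b d) : TangleLink r c d := by
  obtain ⟨x, y, e, f, hx, he, h⟩ := h
  exact ⟨x, y, e, f, ha.trans hx, he.trans hb, h⟩

theorem TangleLink.exists_topAdj (h : TangleLink r a b) : ∃ c, TopAdj r b c := by
  obtain ⟨x, y, e, f, hx, he, h1, h2, h3, h4⟩ := h
  exact he.exists_topAdj (c := f) ⟨x, y, h1, h2, h3, h4⟩

theorem TangleLink.exists_topAdj_flip (h : TangleLink r a b) : ∃ c, TopAdj (flip r) a c :=
  h.dual.exists_topAdj

theorem TopConn.exists_split (h : TopConn r c d) (h1 : r x c) (h2 : ¬ r x d) :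
    ∃ e f, TopConn r c e ∧ TopAdj r e f ∧ r x e ∧ ¬ r x f := by
  induction h with
  | refl => exact absurd h1 h2
  | @tail e f h h' ih =>
    by_cases he : r x e
    · exact ⟨e, f, h, h', he, h2⟩
    · exact ih he

theorem TopConn.tangleLink (h : TopConn r c d) (h1 : r x c) (h2 : ¬ r x d) :
    TangleLink r x d := by
  obtain ⟨e, f, hce, ⟨p, y, -, -, h3, h4⟩, h5, h6⟩ := h.exists_split h1 h2
  exact ⟨x, y, e, f, .refl, hce.symm.trans h, h5, h6, h3, h4⟩

theorem topAdj_flip (h1 : r x c) (h2 : ¬ r x d) (h3 : r y d) (h4 : ¬ r y c) :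
    TopAdj (flip r) x y := ⟨c, d, h1, h4, h3, h2⟩

theorem topConn_flip_of_split (h : TopAdj r c d) (h1 : r x c) (h2 : ¬ r x d)
    (h3 : r y c) (h4 : ¬ r y d) : TopConn (flip r) x y := by
  obtain ⟨-, q, -, -, h5, h6⟩ := h
  exact .tail (.single (topAdj_flip h1 h2 h5 h6)) (topAdj_flip h3 h4 h5 h6).symm

theorem topConn_flip_of_adj (h : TopAdj r c d) (h' : TopAdj r c b) (h1 : r x c)
    (h2 : ¬ r x d) (h3 : r y c) (h4 : ¬ r y b) : TopConn (flip r) x y := by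
  by_cases h5 : r x b
  · by_cases h6 : r y d
    · exact .single ⟨b, d, h5, h4, h6, h2⟩
    · exact topConn_flip_of_split h h1 h2 h3 h6
  · exact topConn_flip_of_split h' h1 h5 h3 h4

/-- All elements that distinguish the downsets of two members of a top lie in one bottom. -/
theorem TopConn.topConn_flip (h : TopConn r c d) (hc : TopAdj r c a) (hd : TopAdj r d b)
    (h1 : r x c) (h2 : ¬ r x a) (h3 : r y d) (h4 : ¬ r y b) : TopConn (flip r) x y := by
  induction h generalizing b y with
  | refl => exact topConn_flip_of_adj hc hd h1 h2 h3 h4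
  | @tail d e h h' ih =>
    obtain ⟨p, q, hp, hp', hq, hq'⟩ := id h'
    exact ((ih h' hp hp').tail (topAdj_flip hp hp' hq hq')).trans
      (topConn_flip_of_adj h'.symm hd hq hq' h3 h4)

theorem TangleLink.topConn_flip (h : TangleLink r a c) (h' : TangleLink r b c) :
    TopConn (flip r) a b := by
  obtain ⟨x, y, e, f, hx, he, h1, h2, h3, h4⟩ := h
  obtain ⟨x', y', e', f', hx', he', h1', h2', h3', h4'⟩ := h'
  exact (hx.trans (TopConn.topConn_flip (he.trans he'.symm) ⟨x, y, h1, h2, h3, h4⟩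
    ⟨x', y', h1', h2', h3', h4'⟩ h1 h2 h1' h2')).trans hx'.symm

theorem SameLE.dual (h : SameLE r ℓ a b) : SameLE (flip r) (fun x => -ℓ x) b a := by
  refine ⟨by simp [h.1], ?_⟩
  rcases h.2 with h | h | h
  · exact .inl h.dual
  · exact .inr (.inr h.symm)
  · exact .inr (.inl h.symm)

theorem UpStep.dual (h : UpStep r ℓ a b) : UpStep (flip r) (fun x => -ℓ x) b a :=
  ⟨by have := h.1; dsimp only; omega, h.2.imp id TangleLink.dual⟩

theorem DownStep.dual (h : DownStep r ℓ a b) : DownStep (flip r) (fun x => -ℓ x) b a :=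
  ⟨by have := h.1; dsimp only; omega, h.2.imp id TangleLink.dual⟩

theorem SameLE.of_dual (h : SameLE (flip r) (fun x => -ℓ x) b a) : SameLE r ℓ a b := by
  simpa using h.dual

theorem UpStep.of_dual (h : UpStep (flip r) (fun x => -ℓ x) b a) : UpStep r ℓ a b := by
  simpa using h.dual

theorem DownStep.of_dual (h : DownStep (flip r) (fun x => -ℓ x) b a) : DownStep r ℓ a b := by
  simpa using h.dual

theorem SamePart.symm (h : SamePart r a b) : SamePart r b a := by
  rcases h with h | h | h | h | h
  · exact .inl h.symm
  · exact .inr (.inl h.symm)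
  · exact .inr (.inr (.inl h.symm))
  · exact .inr (.inr (.inr (.inr h)))
  · exact .inr (.inr (.inr (.inl h)))

end Relations

namespace LevelledFree

variable {β : Type*} {r : β → β → Prop} {ℓ : β → ℤ} {a b c d x y z : β}

theorem dual (h : LevelledFree r ℓ) : LevelledFree (flip r) (fun x => -ℓ x) where
  free h1 h2 d := (h.free h2 h1 d).symm
  lt h1 := neg_lt_neg (h.lt h1)
  rel h1 := h.rel (by omega)
  clone h1 h2 := by rw [h.clone h2.dual h1.dual]

theorem rel_of_topAdj (h : LevelledFree r ℓ) (hab : TopAdj r a b) (hz : r a z) : r b z := by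
  obtain ⟨x, -, h1, h2, -, -⟩ := hab
  exact (h.free h1 hz b).resolve_left h2

theorem rel_of_topConn (h : LevelledFree r ℓ) (hab : TopConn r a b) (hz : r a z) : r b z := by
  induction hab with
  | refl => exact hz
  | tail _ h' ih => exact h.rel_of_topAdj h' ih

theorem level_le_of_topAdj (h : LevelledFree r ℓ) (hab : TopAdj r a b) : ℓ b ≤ ℓ a := by
  obtain ⟨x, -, h1, h2, -, -⟩ := hab
  have := h.lt h1
  have := mt h.rel h2
  omega

theorem level_eq_of_topConn (h : LevelledFree r ℓ) (hab : TopConn r a b) : ℓ a = ℓ b := by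
  induction hab with
  | refl => rfl
  | tail _ h' ih =>
    exact ih.trans ((h.level_le_of_topAdj h'.symm).antisymm (h.level_le_of_topAdj h'))

theorem level_eq_of_topConn_flip (h : LevelledFree r ℓ) (hab : TopConn (flip r) a b) :
    ℓ a = ℓ b :=
  neg_injective (h.dual.level_eq_of_topConn hab)

theorem level_eq_of_tangleLink (h : LevelledFree r ℓ) (hab : TangleLink r a b) :
    ℓ b = ℓ a + 1 := by
  obtain ⟨x, y, c, d, hx, hc, h1, h2, h3, h4⟩ := hab
  rw [← h.level_eq_of_topConn hc, h.level_eq_of_topConn_flip hx]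
  have := h.level_eq_of_topConn (.single ⟨x, y, h1, h2, h3, h4⟩ : TopConn r c d)
  have := h.lt h1
  have := mt h.rel h2
  omega

/-- Tops and bottoms of tangles are disjoint. -/
theorem not_topAdj_flip (h : LevelledFree r ℓ) (hab : TopAdj r a b) : ¬ TopAdj (flip r) a c := by
  intro hac
  obtain ⟨z, -, h1, h2, -, -⟩ := id hac
  obtain ⟨-, y, -, -, h3, h4⟩ := id hab
  rcases h.free h3 (h.rel_of_topAdj hab h1) c with h5 | h5
  · exact h4 (h.dual.rel_of_topAdj hac.symm h5)
  · exact h2 h5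

theorem eq_of_topConn_flip (h : LevelledFree r ℓ) (hab : TopAdj r a b)
    (hac : TopConn (flip r) a c) : a = c :=
  hac.eq_or_topAdj.resolve_right fun ⟨_, h'⟩ => h.not_topAdj_flip hab h'

theorem eq_of_topConn (h : LevelledFree r ℓ) (hab : TopAdj (flip r) a b)
    (hac : TopConn r a c) : a = c :=
  h.dual.eq_of_topConn_flip hab hac

theorem viewLE_of_not_rel (h : LevelledFree r ℓ) (h1 : r a z) (h2 : ¬ r b z) :
    ViewLE r a b ∨ TopAdj (flip r) a b := by
  by_cases hab : TopAdj (flip r) a b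
  · exact .inr hab
  refine .inl ⟨fun x hx => (h.free hx h1 b).resolve_right h2, fun w hw => ?_⟩
  by_contra h3
  exact hab ⟨z, w, h1, h2, hw, h3⟩

theorem viewLE_topConn (h : LevelledFree r ℓ) (hab : ViewLE r a b) (hbc : TopConn r b c) :
    ViewLE r a c ∨ TopConn r a c := by
  induction hbc with
  | refl => exact .inl hab
  | @tail c d hbc hcd ih =>
    rcases ih with ih | ih
    · by_cases h1 : TopAdj r a d
      · exact .inr (.single h1)
      refine .inl ⟨fun x hx => ?_, fun z hz => ih.2 z (h.rel_of_topAdj hcd.symm hz)⟩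
      by_contra h2
      obtain ⟨-, y, -, -, h3, h4⟩ := hcd
      exact h1 ⟨x, y, hx, h2, h3, fun h5 => h4 (ih.1 y h5)⟩
    · exact .inr (ih.tail hcd)

theorem viewLE_topConn_flip (h : LevelledFree r ℓ) (hab : ViewLE r a b)
    (hbc : TopConn (flip r) b c) : ViewLE r a c ∨ TopConn (flip r) a c := by
  induction hbc with
  | refl => exact .inl hab
  | @tail c d hbc hcd ih =>
    rcases ih with ih | ih
    · by_cases h1 : TopAdj (flip r) a d
      · exact .inr (.single h1)
      refine .inl ⟨fun x hx => h.dual.rel_of_topAdj hcd (ih.1 x hx), fun z hz => ?_⟩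
      by_contra h2
      obtain ⟨w, -, h3, h4, -, -⟩ := hcd
      exact h1 ⟨w, z, ih.2 w h3, h4, hz, h2⟩
    · exact .inr (ih.tail hcd)

theorem sameLE_trans_of_viewLE (h : LevelledFree r ℓ) (hab : SameLE r ℓ a b)
    (hv : ViewLE r a b) (hbc : SameLE r ℓ b c) : SameLE r ℓ a c := by
  refine ⟨hab.1.trans hbc.1, ?_⟩
  rcases hbc.2 with hbc | hbc | hbc
  · exact .inl (hv.trans hbc)
  · exact (h.viewLE_topConn hv hbc).imp_right .inl
  · exact (h.viewLE_topConn_flip hv hbc).imp_right .inr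

theorem sameLE_trans (h : LevelledFree r ℓ) (hab : SameLE r ℓ a b) (hbc : SameLE r ℓ b c) :
    SameLE r ℓ a c := by
  rcases hab.2 with h1 | h1 | h1
  · exact h.sameLE_trans_of_viewLE hab h1 hbc
  all_goals rcases hbc.2 with h2 | h2 | h2
  · exact (h.dual.sameLE_trans_of_viewLE hbc.dual h2.dual hab.dual).of_dual
  · exact ⟨hab.1.trans hbc.1, .inr (.inl (h1.trans h2))⟩
  · rcases h1.symm.eq_or_topAdj with rfl | ⟨d, h3⟩
    · exact hbc
    · rwa [← h.eq_of_topConn_flip h3 h2]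
  · exact (h.dual.sameLE_trans_of_viewLE hbc.dual h2.dual hab.dual).of_dual
  · rcases h1.symm.eq_or_topAdj with rfl | ⟨d, h3⟩
    · exact hbc
    · rwa [← h.eq_of_topConn h3 h2]
  · exact ⟨hab.1.trans hbc.1, .inr (.inr (h1.trans h2))⟩

theorem sameLE_of_not_rel (h : LevelledFree r ℓ) (hab : ℓ a = ℓ b) (h1 : r a z)
    (h2 : ¬ r b z) : SameLE r ℓ a b :=
  ⟨hab, (h.viewLE_of_not_rel h1 h2).imp_right fun h => .inr (.single h)⟩

theorem upStep_sameLE (h : LevelledFree r ℓ) (hbc : UpStep r ℓ b c) (hcd : SameLE r ℓ c d) :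
    UpStep r ℓ b d := by
  refine ⟨hcd.1 ▸ hbc.1, ?_⟩
  by_contra! hbd
  obtain ⟨hbd, hM⟩ := hbd
  rcases hbc.2 with h1 | h1
  · rcases hcd.2 with h2 | h2 | h2
    · exact hbd (h2.1 b h1)
    · exact hM (h2.tangleLink h1 hbd)
    · exact hbd (h.dual.rel_of_topConn h2 h1)
  · obtain ⟨e, he⟩ := h1.exists_topAdj
    rcases hcd.2 with h2 | h2 | h2
    · obtain ⟨x, y, e, f, hx, he, h3, h4, h5, h6⟩ := h1
      rcases h.dual.viewLE_topConn_flip h2.dual he.symm with h7 | h7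
      · have h8 := TopConn.tangleLink (r := flip r) hx.symm (h7.2 x h3) hbd
        exact hM h8.dual
      · exact hM ⟨x, y, e, f, hx, h7.symm, h3, h4, h5, h6⟩
    · exact hM (h1.of_conn .refl h2)
    · exact hM (h.eq_of_topConn_flip he h2 ▸ h1)

theorem downStep_sameLE (h : LevelledFree r ℓ) (hbc : DownStep r ℓ b c) (hcd : SameLE r ℓ c d) :
    DownStep r ℓ b d := by
  refine ⟨hcd.1 ▸ hbc.1, ?_⟩
  by_contra! hbd
  obtain ⟨hbd, hM⟩ := hbd
  rcases hbc.2 with h1 | h1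
  · rcases hcd.2 with h2 | h2 | h2
    · exact h1 (h2.2 b hbd)
    · exact h1 (h.rel_of_topConn h2.symm hbd)
    · exact hM ((TopConn.tangleLink (r := flip r) h2.symm hbd h1).dual.of_conn h2.symm .refl)
  · obtain ⟨e, he⟩ := h1.exists_topAdj_flip
    rcases hcd.2 with h2 | h2 | h2
    · obtain ⟨x, y, e, f, hx, he, h3, h4, h5, h6⟩ := h1
      rcases h.dual.viewLE_topConn h2.dual hx with h7 | h7
      · have h8 : TopConn r f b := .head (TopAdj.symm ⟨x, y, h3, h4, h5, h6⟩) he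
        exact hM ((h8.symm.tangleLink hbd fun h9 => h4 (h7.1 f h9)).of_conn .refl h8)
      · exact hM ⟨x, y, e, f, h7, he, h3, h4, h5, h6⟩
    · exact hM (h.eq_of_topConn he h2 ▸ h1)
    · exact hM (h1.of_conn h2.symm .refl)

theorem sameLE_upStep (h : LevelledFree r ℓ) (hab : SameLE r ℓ a b) (hbc : UpStep r ℓ b c) :
    UpStep r ℓ a c :=
  (h.dual.upStep_sameLE hbc.dual hab.dual).of_dual

theorem sameLE_downStep (h : LevelledFree r ℓ) (hab : SameLE r ℓ a b)
    (hbc : DownStep r ℓ b c) : DownStep r ℓ a c :=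
  (h.dual.downStep_sameLE hbc.dual hab.dual).of_dual

theorem sameLE_of_topConn_flip (h : LevelledFree r ℓ) (hab : TopConn (flip r) a b) :
    SameLE r ℓ a b :=
  ⟨h.level_eq_of_topConn_flip hab, .inr (.inr hab)⟩

theorem upStep_downStep (h : LevelledFree r ℓ) (hab : UpStep r ℓ a c)
    (hbc : DownStep r ℓ c b) : SameLE r ℓ a b := by
  have hl : ℓ a = ℓ b := by have := hab.1; have := hbc.1; omega
  rcases hab.2 with h1 | h1 <;> rcases hbc.2 with h2 | h2
  · exact h.sameLE_of_not_rel hl h1 h2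
  · by_cases h3 : TangleLink r a c
    · exact h.sameLE_of_topConn_flip (h3.topConn_flip h2)
    obtain ⟨x, y, e, f, hx, he, h4, h5, h6, h7⟩ := h2
    have hf : TopConn r c f := he.symm.tail ⟨x, y, h4, h5, h6, h7⟩
    have h8 : r a f := by
      by_contra h8
      exact h3 ((hf.tangleLink h1 h8).of_conn .refl hf.symm)
    exact h.sameLE_trans
      (h.sameLE_of_not_rel (hl.trans (h.level_eq_of_topConn_flip hx)) h8 h5)
      (h.sameLE_of_topConn_flip hx.symm)
  · by_cases h3 : TangleLink r b c
    · exact h.sameLE_of_topConn_flip (h1.topConn_flip h3)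
    obtain ⟨x, y, e, f, hx, he, h4, h5, h6, h7⟩ := h1
    have h8 : ¬ r b e := fun h8 => h3 (he.tangleLink h8 h2)
    exact h.sameLE_trans (h.sameLE_of_topConn_flip hx)
      (h.sameLE_of_not_rel ((h.level_eq_of_topConn_flip hx).symm.trans hl) h4 h8)
  · exact h.sameLE_of_topConn_flip (h1.topConn_flip h2)

theorem downStep_upStep (h : LevelledFree r ℓ) (hab : DownStep r ℓ a c)
    (hbc : UpStep r ℓ c b) : SameLE r ℓ a b :=
  (h.dual.upStep_downStep hbc.dual hab.dual).of_dual

theorem sameLE_refl (r : β → β → Prop) (ℓ : β → ℤ) (a : β) : SameLE r ℓ a a :=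
  ⟨rfl, .inr (.inl .refl)⟩

theorem listLE_sameLE (h : LevelledFree r ℓ) (hab : ListLE r ℓ a b) (hbc : SameLE r ℓ b c) :
    ListLE r ℓ a c := by
  rcases hab with hab | hab | hab
  · exact .inl (h.sameLE_trans hab hbc)
  · obtain ⟨d, had, hdb⟩ := TransGen.tail'_iff.1 hab
    exact .inr (.inl (.tail' had (h.upStep_sameLE hdb hbc)))
  · obtain ⟨d, had, hdb⟩ := TransGen.tail'_iff.1 hab
    exact .inr (.inr (.tail' had (h.downStep_sameLE hdb hbc)))

theorem listLE_upStep (h : LevelledFree r ℓ) (hab : ListLE r ℓ a b) (hbc : UpStep r ℓ b c) :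
    ListLE r ℓ a c := by
  rcases hab with hab | hab | hab
  · exact .inr (.inl (.single (h.sameLE_upStep hab hbc)))
  · exact .inr (.inl (hab.tail hbc))
  · obtain ⟨d, had, hdb⟩ := TransGen.tail'_iff.1 hab
    have hdc := h.downStep_upStep hdb hbc
    rcases reflTransGen_iff_eq_or_transGen.1 had with rfl | had
    · exact .inl hdc
    · exact h.listLE_sameLE (.inr (.inr had)) hdc

theorem listLE_downStep (h : LevelledFree r ℓ) (hab : ListLE r ℓ a b)
    (hbc : DownStep r ℓ b c) : ListLE r ℓ a c := by
  rcases hab with hab | hab | hab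
  · exact .inr (.inr (.single (h.sameLE_downStep hab hbc)))
  · obtain ⟨d, had, hdb⟩ := TransGen.tail'_iff.1 hab
    have hdc := h.upStep_downStep hdb hbc
    rcases reflTransGen_iff_eq_or_transGen.1 had with rfl | had
    · exact .inl hdc
    · exact h.listLE_sameLE (.inr (.inl had)) hdc
  · exact .inr (.inr (hab.tail hbc))

theorem listLE_trans (h : LevelledFree r ℓ) (hab : ListLE r ℓ a b) (hbc : ListLE r ℓ b c) :
    ListLE r ℓ a c := by
  rcases hbc with hbc | hbc | hbc
  · exact h.listLE_sameLE hab hbc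
  · induction hbc with
    | single hbc => exact h.listLE_upStep hab hbc
    | tail _ hbc ih => exact h.listLE_upStep ih hbc
  · induction hbc with
    | single hbc => exact h.listLE_downStep hab hbc
    | tail _ hbc ih => exact h.listLE_downStep ih hbc

theorem level_lt_of_transGen_upStep (hab : TransGen (UpStep r ℓ) a b) : ℓ a < ℓ b := by
  induction hab with
  | single hab => have := hab.1; omega
  | tail _ hab ih => have := hab.1; omega

theorem level_lt_of_transGen_downStep (hab : TransGen (DownStep r ℓ) a b) : ℓ b < ℓ a := by
  induction hab with
  | single hab => have := hab.1; omega
  | tail _ hab ih => have := hab.1; omega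

theorem tangleLink_of_listLE (hab : UpStep r ℓ a b)
    (hba : ListLE r ℓ b a) : TangleLink r a b := by
  have hl := hab.1
  rcases hba with hba | hba | hba
  · have := hba.1; omega
  · have := level_lt_of_transGen_upStep hba; omega
  · obtain ⟨d, hbd, hda⟩ := TransGen.tail'_iff.1 hba
    rcases reflTransGen_iff_eq_or_transGen.1 hbd with rfl | hbd
    · rcases hab.2 with h1 | h1
      · exact hda.2.resolve_left (absurd h1)
      · exact h1
    · have := level_lt_of_transGen_downStep hbd
      have := hda.1
      omega

theorem tangleLink_of_transGen_upStep (h : LevelledFree r ℓ)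
    (hab : TransGen (UpStep r ℓ) a b) (hba : ListLE r ℓ b a) : TangleLink r a b := by
  obtain ⟨d, had, hdb⟩ := TransGen.tail'_iff.1 hab
  have h1 : TangleLink r d b := by
    refine tangleLink_of_listLE hdb ?_
    rcases reflTransGen_iff_eq_or_transGen.1 had with rfl | had
    · exact hba
    · exact h.listLE_trans hba (.inr (.inl had))
  rcases reflTransGen_iff_eq_or_transGen.1 had with rfl | had
  · exact h1
  obtain ⟨e, hae, hed⟩ := TransGen.tail'_iff.1 had
  have h2 : ListLE r ℓ d e := by
    refine h.listLE_trans (h.listLE_upStep (.inl (sameLE_refl r ℓ d)) hdb) ?_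
    rcases reflTransGen_iff_eq_or_transGen.1 hae with rfl | hae
    · exact hba
    · exact h.listLE_trans hba (.inr (.inl hae))
  obtain ⟨_, h3⟩ := (tangleLink_of_listLE hed h2).exists_topAdj
  obtain ⟨_, h4⟩ := h1.exists_topAdj_flip
  exact absurd h4 (h.not_topAdj_flip h3)

theorem samePart_of_listLE (h : LevelledFree r ℓ) (hab : ListLE r ℓ a b)
    (hba : ListLE r ℓ b a) : SamePart r a b := by
  rcases hab with h1 | h1 | h1
  · rcases h1.2 with h2 | h2
    · rcases hba with h3 | h3 | h3
      · rcases h3.2 with h3 | h3 | h3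
        · exact .inl ⟨h2, h3⟩
        · exact .inr (.inl h3.symm)
        · exact .inr (.inr (.inl h3.symm))
      · have := h1.1; have := level_lt_of_transGen_upStep h3; omega
      · have := h1.1; have := level_lt_of_transGen_downStep h3; omega
    · exact .inr (h2.imp_right .inl)
  · exact .inr (.inr (.inr (.inl (h.tangleLink_of_transGen_upStep h1 hba))))
  · rcases hba with h3 | h3 | h3
    · have := h3.1; have := level_lt_of_transGen_downStep h1; omega
    · exact .inr (.inr (.inr (.inr
        (h.tangleLink_of_transGen_upStep h3 (.inr (.inr h1))))))
    · have := level_lt_of_transGen_downStep h1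
      have := level_lt_of_transGen_downStep h3
      omega

theorem listLE_of_samePart (h : LevelledFree r ℓ) (hab : SamePart r a b) : ListLE r ℓ a b := by
  rcases hab with h1 | h1 | h1 | h1 | h1
  · exact .inl ⟨h.clone h1.1 h1.2, .inl h1.1⟩
  · exact .inl ⟨h.level_eq_of_topConn h1, .inr (.inl h1)⟩
  · exact .inl (h.sameLE_of_topConn_flip h1)
  · exact .inr (.inl (.single ⟨h.level_eq_of_tangleLink h1, .inr h1⟩))
  · exact .inr (.inr (.single ⟨h.level_eq_of_tangleLink h1, .inr h1⟩))

theorem samePart_trans (h : LevelledFree r ℓ) (hab : SamePart r a b) (hbc : SamePart r b c) :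
    SamePart r a c :=
  h.samePart_of_listLE (h.listLE_trans (h.listLE_of_samePart hab) (h.listLE_of_samePart hbc))
    (h.listLE_trans (h.listLE_of_samePart hbc.symm) (h.listLE_of_samePart hab.symm))

end LevelledFree

section Parts

variable {β : Type*} [PartialOrder β] {a b c d x y : β}

theorem ttrel_eq_topAdj : (TTrel : β → β → Prop) = TopAdj (· < ·) := by
  funext a b
  simp only [TTrel, TopAdj, Set.not_subset, Dset, Set.mem_ofPred_eq, eq_iff_iff]
  tauto

theorem bbrel_eq_topAdj : (BBrel : β → β → Prop) = TopAdj (flip (· < ·)) := by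
  funext a b
  simp only [BBrel, TopAdj, Set.not_subset, Uset, Set.mem_ofPred_eq, eq_iff_iff, flip]
  tauto

theorem view_eq_iff : view a = view b ↔ ViewLE (· < ·) a b ∧ ViewLE (· < ·) b a := by
  simp only [view, Prod.mk.injEq, compl_inj_iff, Set.ext_iff, Dset, Uset, Set.mem_ofPred_eq,
    ViewLE]
  grind

theorem TopAdj.ne {γ : Type*} {r : γ → γ → Prop} {a b : γ} (h : TopAdj r a b) : a ≠ b := by
  rintro rfl
  obtain ⟨x, -, h1, h2, -⟩ := h
  exact h2 h1

theorem two_le_ncard_topConn_iff {γ : Type*} [Finite γ] {r : γ → γ → Prop} {a : γ} :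
    2 ≤ {b | TopConn r a b}.ncard ↔ ∃ b, TopAdj r a b := by
  constructor
  · intro h
    obtain ⟨b, hb, hne⟩ := Set.exists_ne_of_one_lt_ncard h a
    exact (TopConn.eq_or_topAdj hb).resolve_left hne.symm
  · rintro ⟨b, hb⟩
    exact (Set.one_lt_ncard (Set.toFinite _)).2 ⟨a, .refl, b, .single hb, hb.ne⟩

theorem isTopOfTangle_iff [Finite β] {A : Set β} :
    IsTopOfTangle A ↔ ∃ a b, TopAdj (· < ·) a b ∧ A = {x | TopConn (· < ·) a x} := by
  rw [IsTopOfTangle, ttrel_eq_topAdj]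
  constructor
  · rintro ⟨h, a, rfl⟩
    obtain ⟨b, hb⟩ := two_le_ncard_topConn_iff.1 h
    exact ⟨a, b, hb, rfl⟩
  · rintro ⟨a, b, hb, rfl⟩
    exact ⟨two_le_ncard_topConn_iff.2 ⟨b, hb⟩, a, rfl⟩

theorem isBottomOfTangle_iff [Finite β] {A : Set β} :
    IsBottomOfTangle A ↔
      ∃ a b, TopAdj (flip (· < ·)) a b ∧ A = {x | TopConn (flip (· < ·)) a x} := by
  rw [IsBottomOfTangle, bbrel_eq_topAdj]
  constructor
  · rintro ⟨h, a, rfl⟩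
    obtain ⟨b, hb⟩ := two_le_ncard_topConn_iff.1 h
    exact ⟨a, b, hb, rfl⟩
  · rintro ⟨a, b, hb, rfl⟩
    exact ⟨two_le_ncard_topConn_iff.2 ⟨b, hb⟩, a, rfl⟩

theorem notInTanglePart_iff [Finite β] :
    NotInTanglePart a ↔
      (¬ ∃ b, TopAdj (· < ·) a b) ∧ ¬ ∃ b, TopAdj (flip (· < ·)) a b := by
  simp only [NotInTanglePart, isTopOfTangle_iff, isBottomOfTangle_iff]
  refine and_congr ?_ ?_ <;> constructor
  · rintro h ⟨b, hb⟩
    exact h _ ⟨a, b, hb, rfl⟩ ReflTransGen.refl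
  · rintro h _ ⟨c, d, hcd, rfl⟩ hca
    exact h (TopConn.exists_topAdj hca hcd)
  · rintro h ⟨b, hb⟩
    exact h _ ⟨a, b, hb, rfl⟩ ReflTransGen.refl
  · rintro h _ ⟨c, d, hcd, rfl⟩ hca
    exact h (TopConn.exists_topAdj hca hcd)

theorem setOf_samePart_of_notInTanglePart [Finite β] (h : NotInTanglePart a) :
    {b | SamePart (· < ·) a b} = {b | NotInTanglePart b ∧ view b = view a} := by
  obtain ⟨h1, h2⟩ := notInTanglePart_iff.1 h
  ext b
  constructor
  · suffices SamePart (· < ·) a b → view b = view a by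
      intro hb
      have hv := this hb
      have hD : Dset b = Dset a := congrArg Prod.fst hv
      have hU : Uset b = Uset a := compl_injective (congrArg Prod.snd hv)
      refine ⟨notInTanglePart_iff.2 ?_, hv⟩
      rw [← ttrel_eq_topAdj] at h1 ⊢
      rw [← bbrel_eq_topAdj] at h2 ⊢
      simp only [TTrel, BBrel] at h1 h2 ⊢
      rw [hD, hU]
      exact ⟨h1, h2⟩
    rintro (h3 | h3 | h3 | h3 | h3)
    · exact view_eq_iff.2 h3.symm
    · rw [h3.eq_or_topAdj.resolve_right h1]
    · rw [h3.eq_or_topAdj.resolve_right h2]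
    · exact absurd h3.exists_topAdj_flip h2
    · exact absurd h3.exists_topAdj h1
  · rintro ⟨-, hb⟩
    exact .inl (view_eq_iff.1 hb.symm)

theorem setOf_samePart_of_tangleLink {ℓ : β → ℤ} (hℓ : LevelledFree (· < ·) ℓ)
    (h : TangleLink (· < ·) b a) :
    {x | SamePart (· < ·) a x} =
      {x | TopConn (· < ·) a x} ∪ {x | TopConn (flip (· < ·)) b x} := by
  obtain ⟨c, hc⟩ := h.exists_topAdj
  ext x
  constructor
  · rintro (h3 | h3 | h3 | h3 | h3)
    · obtain ⟨p, q, h4, h5, h6, h7⟩ := id hc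
      exact .inl (.tail (.single hc)
        ⟨q, p, h6, fun h8 => h7 (h3.2.1 q h8), h3.1.1 p h4, h5⟩)
    · exact .inl h3
    · exact .inl (hℓ.eq_of_topConn_flip hc h3 ▸ .refl)
    · obtain ⟨d, hd⟩ := h3.exists_topAdj_flip
      exact absurd hd (hℓ.not_topAdj_flip hc)
    · exact .inr (h.topConn_flip h3)
  · rintro (h3 | h3)
    · exact .inr (.inl h3)
    · exact .inr (.inr (.inr (.inr (h.of_conn (TopConn.symm h3) .refl))))

theorem Matched.tangleLink {A B : Set β} (h : Matched A B)
    (hA : ∀ x ∈ A, TopConn (· < ·) x a) (hB : ∀ x ∈ B, TopConn (flip (· < ·)) b x) :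
    TangleLink (· < ·) b a := by
  obtain ⟨c, hc, d, hd, x, hx, y, hy, h1, h2, -, -, h3, h4⟩ := h
  exact ⟨x, y, c, d, hB x hx, hA c hc, h1, fun h => h4.2 h.le, h2, fun h => h3.2 h.le⟩

theorem TangleLink.isTangle [Finite β] (h : TangleLink (· < ·) b a) :
    IsTangle ({x | TopConn (· < ·) a x} ∪ {x | TopConn (flip (· < ·)) b x}) := by
  obtain ⟨e, he⟩ := h.exists_topAdj
  obtain ⟨f, hf⟩ := h.exists_topAdj_flip
  refine ⟨_, _, isTopOfTangle_iff.2 ⟨a, e, he, rfl⟩, isBottomOfTangle_iff.2 ⟨b, f, hf, rfl⟩,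
    ?_, rfl⟩
  obtain ⟨x, y, c, d, hx, hc, h1, h2, h3, h4⟩ := h
  refine ⟨c, hc.symm, d, hc.symm.tail ⟨x, y, h1, h2, h3, h4⟩, x, hx, y,
    ReflTransGen.tail hx (topAdj_flip h1 h2 h3 h4), h1, h3, ?_, ?_, ?_, ?_⟩ <;>
    constructor <;> intro h5
  · exact h2 (h1.trans_le h5)
  · exact h4 (h3.trans_le h5)
  · exact h2 (h5.trans_lt h3)
  · exact h4 (h5.trans_lt h1)
  · exact h2 (h1.trans_le (h5.trans h3.le))
  · exact h4 (h5.lt_of_ne fun h6 => h2 (h1.trans (h6 ▸ h3)))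
  · exact h4 (h3.trans_le (h5.trans h1.le))
  · exact h2 (h5.lt_of_ne fun h6 => h4 (h3.trans (h6 ▸ h1)))

theorem isPart_iff [Finite β] {ℓ : β → ℤ} (hℓ : LevelledFree (· < ·) ℓ) {Y : Set β} :
    IsPart Y ↔ ∃ a, {b | SamePart (· < ·) a b} = Y := by
  constructor
  · rintro (⟨a, ha, rfl⟩ | ⟨A, B, hA, hB, hM, rfl⟩)
    · exact ⟨a, setOf_samePart_of_notInTanglePart ha⟩
    · obtain ⟨a, -, -, rfl⟩ := isTopOfTangle_iff.1 hA
      obtain ⟨b, -, -, rfl⟩ := isBottomOfTangle_iff.1 hB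
      exact ⟨a, setOf_samePart_of_tangleLink hℓ
        (hM.tangleLink (fun x hx => TopConn.symm hx) fun x hx => hx)⟩
  · have key : ∀ a b : β, TangleLink (· < ·) b a → IsPart {x | SamePart (· < ·) a x} := by
      intro a b h
      rw [setOf_samePart_of_tangleLink hℓ h]
      exact .inr h.isTangle
    rintro ⟨a, rfl⟩
    by_cases h1 : ∃ b, TopAdj (· < ·) a b
    · obtain ⟨b, x, y, h2, h3, h4, h5⟩ := h1
      exact key a x ⟨x, y, a, b, .refl, .refl, h2, h3, h4, h5⟩
    by_cases h2 : ∃ b, TopAdj (flip (· < ·)) a b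
    · obtain ⟨b, x, y, h2, h3, h4, h5⟩ := h2
      have h6 : TangleLink (· < ·) a x := ⟨a, b, x, y, .refl, .refl, h2, h5, h4, h3⟩
      have h7 : SamePart (· < ·) a x := .inr (.inr (.inr (.inl h6)))
      convert key x a h6 using 1
      ext c
      exact ⟨fun h => hℓ.samePart_trans h7.symm h, fun h => hℓ.samePart_trans h7 h⟩
    · have h3 := notInTanglePart_iff.2 ⟨h1, h2⟩
      exact .inl ⟨a, h3, setOf_samePart_of_notInTanglePart h3⟩

end Parts

section Level

variable {β : Type*} [PartialOrder β] [Fintype β] {a b : β}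

theorem bddAbove_chain_card (a : β) :
    BddAbove {n | ∃ s : Finset β, s.card = n ∧ IsChain (· ≤ ·) (↑s : Set β) ∧ a ∈ s ∧
      ∀ x ∈ s, x ≤ a} :=
  ⟨Fintype.card β, by rintro _ ⟨s, rfl, -⟩; exact s.card_le_univ⟩

theorem exists_chain_card_eq_level (a : β) :
    ∃ s : Finset β, s.card = level a ∧ IsChain (· ≤ ·) (↑s : Set β) ∧ a ∈ s ∧
      ∀ x ∈ s, x ≤ a :=
  Nat.sSup_mem (s := {n | ∃ s : Finset β, s.card = n ∧ IsChain (· ≤ ·) (↑s : Set β) ∧ a ∈ s ∧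
    ∀ x ∈ s, x ≤ a}) ⟨1, {a}, by simp⟩ (bddAbove_chain_card a)

theorem card_le_level {s : Finset β} (hs : IsChain (· ≤ ·) (↑s : Set β)) (ha : a ∈ s)
    (h : ∀ x ∈ s, x ≤ a) : s.card ≤ level a :=
  le_csSup (bddAbove_chain_card a) ⟨s, rfl, hs, ha, h⟩

theorem one_le_level (a : β) : 1 ≤ level a := by
  simpa using card_le_level (s := {a}) (a := a) (by simp) (by simp) (by simp)

theorem level_lt_level (h : a < b) : level a < level b := by
  classical
  obtain ⟨s, hs, hc, ha, hle⟩ := exists_chain_card_eq_level a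
  have hb : b ∉ s := fun hb => (hle b hb).not_gt h
  rw [← hs, Nat.lt_iff_add_one_le, ← Finset.card_insert_of_notMem hb]
  refine card_le_level ?_ (Finset.mem_insert_self b s) ?_
  · rw [Finset.coe_insert]
    exact hc.insert fun x hx _ => .inr ((hle x hx).trans h.le)
  · simp only [Finset.mem_insert, forall_eq_or_imp, le_refl, true_and]
    exact fun x hx => (hle x hx).trans h.le

theorem exists_lt_level_add_one_eq (h : 2 ≤ level a) : ∃ b < a, level b + 1 = level a := by
  classical
  obtain ⟨s, hs, hc, ha, hle⟩ := exists_chain_card_eq_level a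
  have hcard := Finset.card_erase_add_one ha
  have hc' : IsChain (· ≤ ·) (↑(s.erase a) : Set β) :=
    hc.mono (Finset.coe_subset.2 (s.erase_subset a))
  obtain ⟨b, hb⟩ := (s.erase a).exists_maximal (Finset.card_pos.1 (by omega))
  have hba : b < a :=
    (hle b (Finset.mem_of_mem_erase hb.1)).lt_of_ne (Finset.ne_of_mem_erase hb.1)
  have h1 := card_le_level hc' hb.1 fun x hx =>
    (hc'.total hx hb.1).elim id fun h => hb.2 hx h
  have h2 := level_lt_level hba
  exact ⟨b, hba, by omega⟩

theorem ThreePlusOneFree.levelledFree (h : ThreePlusOneFree β) :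
    LevelledFree (· < ·) (fun a : β => (level a : ℤ)) := by
  have free : ∀ {a b c : β}, a < b → b < c → ∀ d, a < d ∨ d < c := by
    intro a b c hab hbc d
    by_contra! hd
    refine h ⟨a, b, c, d, hab, hbc, ⟨fun h1 => hd.2 (h1.trans_lt (hab.trans hbc)), fun h1 => ?_⟩,
      ⟨fun h1 => hd.2 (h1.trans_lt hbc), fun h1 => hd.1 (hab.trans_le h1)⟩,
      ⟨fun h1 => ?_, fun h1 => hd.1 ((hab.trans hbc).trans_le h1)⟩⟩
    · rcases h1.eq_or_lt with rfl | h1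
      exacts [hd.2 (hab.trans hbc), hd.1 h1]
    · rcases h1.eq_or_lt with rfl | h1
      exacts [hd.1 (hab.trans hbc), hd.2 h1]
  have le_of_view : ∀ {a b : β}, ViewLE (· < ·) b a → level b ≤ level a := by
    intro a b hv
    by_contra! hlt
    have := one_le_level a
    obtain ⟨c, hc, hc'⟩ := exists_lt_level_add_one_eq (a := b) (by omega)
    have := level_lt_level (hv.1 c hc)
    omega
  refine ⟨free, fun h => by exact_mod_cast level_lt_level h, fun {a b} hab => ?_,
    fun h1 h2 => by exact_mod_cast (le_of_view h1).antisymm (le_of_view h2)⟩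
  have := one_le_level a
  obtain ⟨c, hc, hc'⟩ := exists_lt_level_add_one_eq (a := b) (by omega)
  obtain ⟨d, hd, hd'⟩ := exists_lt_level_add_one_eq (a := c) (by omega)
  rcases free hd hc a with h1 | h1
  · have := level_lt_level h1
    omega
  · exact h1

end Level

/-- A preorder on a finite type admits a monotone ranking whose level sets are exactly the
equivalence classes. -/
theorem exists_rank_of_preorder {β : Type*} [Finite β] (p : β → β → Prop)
    (hrefl : ∀ a, p a a) (htrans : ∀ a b c, p a b → p b c → p a c) :
    ∃ (k : ℕ) (f : β → Fin k), Function.Surjective f ∧ (∀ a b, p a b → f a ≤ f b) ∧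
      ∀ a b, f a = f b → p a b := by
  let _ : Preorder β := { le := p, le_refl := hrefl, le_trans := htrans }
  let _ : Fintype (LinearExtension (Antisymmetrization β (· ≤ ·))) :=
    @Fintype.ofFinite _ (Quotient.finite _)
  let e := (Fintype.orderIsoFinOfCardEq
    (LinearExtension (Antisymmetrization β (· ≤ ·))) rfl).symm
  refine ⟨_, fun a => e (toLinearExtension (toAntisymmetrization (· ≤ ·) a)), ?_, ?_, ?_⟩
  · exact e.surjective.comp Quotient.mk_surjective
  · intro a b hab
    exact e.monotone (toLinearExtension.monotone (toAntisymmetrization_mono hab))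
  · intro a b hab
    exact (Quotient.exact (e.injective hab) : AntisymmRel (· ≤ ·) a b).1

/-- Every finite `(3+1)`-free poset admits a compatible listing
`(X_1, …, X_{r+s})` of its parts (clone sets and tangles): for vertices `a ∈ X_i`,
`b ∈ X_j` with `i ≠ j`, `a < b` holds exactly when `ℓ(a) ≤ ℓ(b) - 2`, or
`ℓ(a) = ℓ(b) - 1` and `i < j`. -/
theorem exists_compatible_listing {α : Type*} [Fintype α] [PartialOrder α]
    (h : ThreePlusOneFree α) :
    ∃ (k : ℕ) (X : Fin k → Set α),
      Function.Injective X ∧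
      (∀ Y : Set α, IsPart Y ↔ ∃ i, X i = Y) ∧
      (∀ i j : Fin k, i ≠ j → ∀ a ∈ X i, ∀ b ∈ X j,
        (a < b ↔ (level a + 2 ≤ level b ∨ (level a + 1 = level b ∧ i < j)))) := by
  have hℓ := h.levelledFree
  obtain ⟨k, f, hf, hmono, hinj⟩ := exists_rank_of_preorder
    (ListLE (· < ·) fun a : α => (level a : ℤ)) (fun a => .inl (LevelledFree.sameLE_refl _ _ a))
    fun _ _ _ => hℓ.listLE_trans
  have hpart : ∀ a b : α, f a = f b ↔ SamePart (· < ·) a b := fun a b =>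
    ⟨fun hab => hℓ.samePart_of_listLE (hinj a b hab) (hinj b a hab.symm), fun hab =>
      (hmono a b (hℓ.listLE_of_samePart hab)).antisymm
        (hmono b a (hℓ.listLE_of_samePart hab.symm))⟩
  refine ⟨k, fun i => {a | f a = i}, ?_, fun Y => ?_, ?_⟩
  · intro i j hij
    obtain ⟨a, rfl⟩ := hf i
    exact (Set.ext_iff.1 hij a).1 rfl
  · rw [isPart_iff hℓ, hf.exists]
    simp only [← hpart, eq_comm]
  · rintro _ _ hij a rfl b rfl
    constructor
    · intro hab
      have := level_lt_level hab
      by_cases h1 : level a + 2 ≤ level b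
      · exact .inl h1
      have h2 : level a + 1 = level b := by omega
      refine .inr ⟨h2, (hmono a b (.inr (.inl (.single ⟨?_, .inl hab⟩)))).lt_of_ne hij⟩
      dsimp only
      exact_mod_cast h2.symm
    · rintro (h1 | ⟨h1, h2⟩)
      · exact hℓ.rel (by exact_mod_cast h1)
      · by_contra h3
        refine (hmono b a (.inr (.inr (.single ⟨?_, .inl h3⟩)))).not_gt h2
        dsimp only
        exact_mod_cast h1.symm
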